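/- arXiv:1808.09617 — 7 statements merged into one kernel-verified Lean document; each statement's English description precedes it below -/
import Mathlib

section
/- For any window size W ≥ 0, any W-warping path 𝒜 of the pair (A,B), and any index 1 ≤ i ≤ L, the path 𝒜 contains at least one pair belonging to the left band ℒ^W_i. -/
noncomputable section

/-- Squared pointwise cost. -/
def delta (x y : ℝ) : ℝ := (x - y) ^ 2

/-- Continuity/monotonicity step of a warping path. -/
def Step (q r : ℕ × ℕ) : Prop :=
  r = (q.1 + 1, q.2) ∨ r = (q.1, q.2 + 1) ∨ r = (q.1 + 1, q.2 + 1)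

/-- A `W`-warping path for series of length `L` (1-based indices). -/
def IsWarpingPath (L W : ℕ) (p : List (ℕ × ℕ)) : Prop :=
  p.head? = some (1, 1) ∧ p.getLast? = some (L, L) ∧ List.Chain' Step p ∧
    ∀ q ∈ p, 1 ≤ q.1 ∧ q.1 ≤ L ∧ 1 ≤ q.2 ∧ q.2 ≤ L ∧ ((q.1 : ℤ) - (q.2 : ℤ)).natAbs ≤ W

/-- Cost of a warping path. -/
def pathCost (A B : ℕ → ℝ) (p : List (ℕ × ℕ)) : ℝ :=
  (p.map (fun q => delta (A q.1) (B q.2))).sum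

/-- `DTW²_W(A,B)`: minimum cost over all `W`-warping paths. -/
def DTW2 (L W : ℕ) (A B : ℕ → ℝ) : ℝ :=
  sInf (pathCost A B '' {p | IsWarpingPath L W p})

/-- Left band `ℒ^W_i`. -/
def leftBand (W i : ℕ) : Finset (ℕ × ℕ) :=
  (Finset.Icc (max 1 (i - W)) i).image (fun j => (j, i)) ∪
    (Finset.Icc (max 1 (i - W)) i).image (fun k => (i, k))

/-- Right band `ℛ^W_i`. -/
def rightBand (L W i : ℕ) : Finset (ℕ × ℕ) :=
  (Finset.Icc i (min L (i + W))).image (fun j => (j, i)) ∪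
    (Finset.Icc i (min L (i + W))).image (fun k => (i, k))

/-- Vertical band `𝒱_i`. -/
def vertBand (L W i : ℕ) : Finset (ℕ × ℕ) :=
  (Finset.Icc (max 1 (i - W)) (min L (i + W))).image (fun j => (i, j))

/-- Minimum of `δ(A_j, B_k)` over a (finite, nonempty) band of pairs `(j,k)`. -/
def bandMin (A B : ℕ → ℝ) (s : Finset (ℕ × ℕ)) : ℝ :=
  sInf ((fun q => delta (A q.1) (B q.2)) '' (s : Set (ℕ × ℕ)))

/-- Upper envelope `𝕌^B_i`. -/
def upperEnv (L W : ℕ) (B : ℕ → ℝ) (i : ℕ) : ℝ :=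
  sSup (B '' Set.Icc (max 1 (i - W)) (min L (i + W)))

/-- Lower envelope `𝕃^B_i`. -/
def lowerEnv (L W : ℕ) (B : ℕ → ℝ) (i : ℕ) : ℝ :=
  sInf (B '' Set.Icc (max 1 (i - W)) (min L (i + W)))

/-- LB_Keogh term `κ_i`. -/
def kappa (L W : ℕ) (A B : ℕ → ℝ) (i : ℕ) : ℝ :=
  if upperEnv L W B i < A i then delta (A i) (upperEnv L W B i)
  else if A i < lowerEnv L W B i then delta (A i) (lowerEnv L W B i)
  else 0

/-- The larger coordinate grows by at most one per step, so it attains every intermediate value. -/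
lemma exists_mem_max_eq_of_chain {i : ℕ} {p : List (ℕ × ℕ)} (hp : p.IsChain Step)
    {a b : ℕ × ℕ} (ha : p.head? = some a) (hb : p.getLast? = some b)
    (hai : max a.1 a.2 ≤ i) (hib : i ≤ max b.1 b.2) :
    ∃ q ∈ p, max q.1 q.2 = i := by
  induction p generalizing a with
  | nil => simp at ha
  | cons x t ih =>
    obtain rfl : x = a := by simpa using ha
    by_cases hx : max x.1 x.2 = i
    · exact ⟨x, by simp, hx⟩
    cases t with
    | nil =>
      obtain rfl : x = b := by simpa using hb
      omega
    | cons y s =>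
      rw [List.isChain_cons_cons] at hp
      have hy : max y.1 y.2 ≤ i := by
        rcases hp.1 with rfl | rfl | rfl <;> dsimp only <;> omega
      obtain ⟨q, hq, hqi⟩ := ih hp.2 rfl (by simpa using hb) hy
      exact ⟨q, List.mem_cons_of_mem x hq, hqi⟩

/-- Every `W`-warping path contains at least one pair of the left band `ℒ^W_i`. -/
theorem path_meets_leftBand (L W : ℕ) (hL : 1 ≤ L) (A B : ℕ → ℝ)
    (p : List (ℕ × ℕ)) (hp : IsWarpingPath L W p)
    (i : ℕ) (hi1 : 1 ≤ i) (hiL : i ≤ L) :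
    ∃ q ∈ p, q ∈ leftBand W i := by
  obtain ⟨hhead, hlast, hchain, hband⟩ := hp
  obtain ⟨q, hq, hqi⟩ := exists_mem_max_eq_of_chain hchain hhead hlast
    (by simpa using hi1) (by simpa using hiL)
  obtain ⟨j, k⟩ := q
  obtain ⟨hj, -, hk, -, hW⟩ := hband _ hq
  refine ⟨(j, k), hq, ?_⟩
  simp only [leftBand, Finset.mem_union, Finset.mem_image, Finset.mem_Icc, Prod.mk.injEq]
  dsimp only at hqi hj hk hW
  rcases le_total j k with h | h
  · exact Or.inl ⟨j, by omega, rfl, by omega⟩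
  · exact Or.inr ⟨k, by omega, by omega, rfl⟩
end
end

section
/- Theorem 1: For any window size W ≥ 0, Σ_{i=1}^{L} min_{(j,k)∈ℒ^W_i} δ(A_j,B_k) ≤ DTW²_W(A,B). -/
noncomputable section

lemma delta_nonneg (x y : ℝ) : 0 ≤ delta x y := sq_nonneg _

/-- The minimum over a band is at most the cost of any of its pairs. -/
lemma bandMin_le (A B : ℕ → ℝ) {s : Finset (ℕ × ℕ)} {q : ℕ × ℕ} (hq : q ∈ s) :
    bandMin A B s ≤ delta (A q.1) (B q.2) := by
  refine csInf_le ⟨0, ?_⟩ ⟨q, hq, rfl⟩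
  rintro _ ⟨r, -, rfl⟩
  exact delta_nonneg _ _

/-- A pair within the window lies in the left band indexed by its larger coordinate. -/
lemma mem_leftBand_max {W : ℕ} {q : ℕ × ℕ} (h1 : 1 ≤ q.1) (h2 : 1 ≤ q.2)
    (hW : ((q.1 : ℤ) - (q.2 : ℤ)).natAbs ≤ W) : q ∈ leftBand W (max q.1 q.2) := by
  obtain ⟨j, k⟩ := q
  simp only [leftBand, Finset.mem_union, Finset.mem_image, Finset.mem_Icc, Prod.mk.injEq] at *
  rcases le_total j k with h | h
  · exact Or.inl ⟨j, by omega, rfl, by omega⟩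
  · exact Or.inr ⟨k, by omega, by omega, rfl⟩

/-- Along a path from `a` to `(L, L)`, the left-band minima for indices beyond `max a.1 a.2` are
paid for by the pairs after `a`. -/
lemma sum_Ioc_bandMin_le_pathCost (L W : ℕ) (A B : ℕ → ℝ) (l : List (ℕ × ℕ)) (a : ℕ × ℕ)
    (hlast : (a :: l).getLast? = some (L, L)) (hstep : List.IsChain Step (a :: l))
    (hmem : ∀ q ∈ l, 1 ≤ q.1 ∧ q.1 ≤ L ∧ 1 ≤ q.2 ∧ q.2 ≤ L ∧
      ((q.1 : ℤ) - (q.2 : ℤ)).natAbs ≤ W) :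
    ∑ i ∈ Finset.Ioc (max a.1 a.2) L, bandMin A B (leftBand W i) ≤ pathCost A B l := by
  induction l generalizing a with
  | nil =>
    obtain rfl : a = (L, L) := by simpa using hlast
    simp [pathCost]
  | cons b l ih =>
    rw [List.isChain_cons_cons] at hstep
    have ihb := ih b (by simpa using hlast) hstep.2 fun q hq => hmem q (List.mem_cons_of_mem _ hq)
    obtain ⟨h1, h1L, h2, h2L, hW⟩ := hmem b List.mem_cons_self
    have hcost : pathCost A B (b :: l) = delta (A b.1) (B b.2) + pathCost A B l := by
      simp [pathCost]
    have hmax : max b.1 b.2 = max a.1 a.2 ∨ max b.1 b.2 = max a.1 a.2 + 1 := by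
      rcases hstep.1 with h | h | h <;> simp only [h] <;> omega
    rw [hcost]
    rcases hmax with h | h
    · rw [← h]
      linarith [delta_nonneg (A b.1) (B b.2)]
    · have hIoc : Finset.Ioc (max a.1 a.2) L =
          insert (max b.1 b.2) (Finset.Ioc (max b.1 b.2) L) := by
        ext i
        simp only [Finset.mem_Ioc, Finset.mem_insert]
        omega
      rw [hIoc, Finset.sum_insert (by simp)]
      exact add_le_add (bandMin_le A B (mem_leftBand_max h1 h2 hW)) ihb

/-- The diagonal is a warping path for every window size. -/
lemma isWarpingPath_diagonal (L W : ℕ) (hL : 1 ≤ L) :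
    IsWarpingPath L W ((List.range' 1 L).map fun i => (i, i)) := by
  obtain ⟨n, rfl⟩ : ∃ n, L = n + 1 := ⟨L - 1, by omega⟩
  refine ⟨by simp [List.range'_succ], ?_, ?_, ?_⟩
  · simp [List.range'_concat, add_comm]
  · refine List.isChain_map_of_isChain (R := fun a b => b = a + 1) _ ?_ (List.isChain_range' 1 _ 1)
    rintro a _ rfl
    exact Or.inr (Or.inr rfl)
  · intro q hq
    obtain ⟨i, hi, rfl⟩ := List.mem_map.1 hq
    rw [List.mem_range'_1] at hi
    simp only
    omega

/-- Theorem 1: the sum of left-band minima is a lower bound on `DTW²_W(A,B)`. -/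
theorem leftBands_lower_bound (L W : ℕ) (hL : 1 ≤ L) (A B : ℕ → ℝ) :
    ∑ i ∈ Finset.Icc 1 L, bandMin A B (leftBand W i) ≤ DTW2 L W A B := by
  refine le_csInf ⟨_, _, isWarpingPath_diagonal L W hL, rfl⟩ ?_
  rintro _ ⟨p, ⟨hhead, hlast, hstep, hmem⟩, rfl⟩
  obtain ⟨l, rfl⟩ := List.head?_eq_some_iff.1 hhead
  -- A virtual start `(0, 0)` makes the first pair of the path an ordinary step.
  have h := sum_Ioc_bandMin_le_pathCost L W A B ((1, 1) :: l) (0, 0) (by simpa using hlast)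
    (List.isChain_cons_cons.2 ⟨Or.inr (Or.inr rfl), hstep⟩) hmem
  have hIoc : Finset.Icc 1 L = Finset.Ioc 0 L := by
    ext i
    simp only [Finset.mem_Icc, Finset.mem_Ioc]
    omega
  rw [hIoc]
  simpa using h
end
end

section
/- For any window size W ≥ 0, any W-warping path 𝒜 of the pair (A,B), and any index 1 ≤ i ≤ L, the path 𝒜 contains at least one pair belonging to the right band ℛ^W_i. -/
noncomputable section

/-- Along a chain of steps the smaller coordinate takes every value between its first and last. -/
theorem exists_min_eq_of_isChain_step {i : ℕ} {p : List (ℕ × ℕ)} {a b : ℕ × ℕ}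
    (hp : p.IsChain Step) (ha : p.head? = some a) (hb : p.getLast? = some b)
    (hai : min a.1 a.2 ≤ i) (hib : i ≤ min b.1 b.2) :
    ∃ q ∈ p, min q.1 q.2 = i := by
  induction p generalizing a with
  | nil => simp at ha
  | cons x l ih =>
    obtain rfl : x = a := by simpa using ha
    by_cases hx : min x.1 x.2 = i
    · exact ⟨x, List.mem_cons_self, hx⟩
    cases l with
    | nil =>
      obtain rfl : x = b := by simpa using hb
      exact absurd (le_antisymm hai hib) hx
    | cons y l =>
      rw [List.isChain_cons_cons] at hp
      have hy : min y.1 y.2 ≤ i := by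
        rcases hp.1 with rfl | rfl | rfl <;> simp only <;> omega
      obtain ⟨q, hq, hqi⟩ := ih hp.2 rfl (by simpa using hb) hy
      exact ⟨q, List.mem_cons_of_mem x hq, hqi⟩

/-- Every `W`-warping path contains at least one pair of the right band `ℛ^W_i`. -/
theorem path_meets_rightBand (L W : ℕ) (hL : 1 ≤ L) (A B : ℕ → ℝ)
    (p : List (ℕ × ℕ)) (hp : IsWarpingPath L W p)
    (i : ℕ) (hi1 : 1 ≤ i) (hiL : i ≤ L) :
    ∃ q ∈ p, q ∈ rightBand L W i := by
  obtain ⟨hhead, hlast, hchain, hmem⟩ := hp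
  obtain ⟨⟨j, k⟩, hq, hqi⟩ :=
    exists_min_eq_of_isChain_step (i := i) hchain hhead hlast (by simpa) (by simpa)
  obtain ⟨hj1, hjL, hk1, hkL, hjk⟩ := hmem _ hq
  refine ⟨(j, k), hq, ?_⟩
  simp only [rightBand, Finset.mem_union, Finset.mem_image, Finset.mem_Icc, Prod.mk.injEq]
  simp only at hqi hj1 hjL hk1 hkL hjk
  rcases le_total j k with h | h
  · exact Or.inr ⟨k, by omega, by omega, rfl⟩
  · exact Or.inl ⟨j, by omega, rfl, by omega⟩
end
end

section
/- For any window size W ≥ 0 and any integer V with 1 ≤ V ≤ L/2, the sets ℒ^W_1,…,ℒ^W_V, 𝒱_{V+1},…,𝒱_{L−V}, ℛ^W_{L−V+1},…,ℛ^W_L are pairwise disjoint: none of these sets intersects any of the others. -/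
noncomputable section

theorem max_eq_of_mem_leftBand {W i : ℕ} {q : ℕ × ℕ} (h : q ∈ leftBand W i) :
    max q.1 q.2 = i := by
  simp only [leftBand, Finset.mem_union, Finset.mem_image, Finset.mem_Icc] at h
  rcases h with ⟨j, ⟨-, hj⟩, rfl⟩ | ⟨k, ⟨-, hk⟩, rfl⟩
  · exact max_eq_right hj
  · exact max_eq_left hk

theorem min_eq_of_mem_rightBand {L W i : ℕ} {q : ℕ × ℕ} (h : q ∈ rightBand L W i) :
    min q.1 q.2 = i := by
  simp only [rightBand, Finset.mem_union, Finset.mem_image, Finset.mem_Icc] at h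
  rcases h with ⟨j, ⟨hj, -⟩, rfl⟩ | ⟨k, ⟨hk, -⟩, rfl⟩
  · exact min_eq_right hj
  · exact min_eq_left hk

theorem fst_eq_of_mem_vertBand {L W i : ℕ} {q : ℕ × ℕ} (h : q ∈ vertBand L W i) :
    q.1 = i := by
  obtain ⟨j, -, rfl⟩ := Finset.mem_image.mp h
  rfl

theorem index_of_mem_band {L W V i : ℕ} {q : ℕ × ℕ}
    (h : q ∈ if i ≤ V then leftBand W i
      else if i ≤ L - V then vertBand L W i else rightBand L W i) :
    i ≤ V ∧ max q.1 q.2 = i ∨ V < i ∧ i ≤ L - V ∧ q.1 = i ∨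
      V < i ∧ L - V < i ∧ min q.1 q.2 = i := by
  split_ifs at h with h₁ h₂
  · exact Or.inl ⟨h₁, max_eq_of_mem_leftBand h⟩
  · exact Or.inr (Or.inl ⟨not_le.mp h₁, h₂, fst_eq_of_mem_vertBand h⟩)
  · exact Or.inr (Or.inr ⟨not_le.mp h₁, not_le.mp h₂, min_eq_of_mem_rightBand h⟩)

/-- The bands `ℒ^W_1,…,ℒ^W_V, 𝒱_{V+1},…,𝒱_{L−V}, ℛ^W_{L−V+1},…,ℛ^W_L` are pairwise
disjoint. -/
theorem bands_pairwise_disjoint (L W V : ℕ) (hL : 1 ≤ L) (hV1 : 1 ≤ V) (hV2 : 2 * V ≤ L) :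
    ∀ i₁ ∈ Finset.Icc 1 L, ∀ i₂ ∈ Finset.Icc 1 L, i₁ ≠ i₂ →
      Disjoint
        (if i₁ ≤ V then leftBand W i₁
          else if i₁ ≤ L - V then vertBand L W i₁ else rightBand L W i₁)
        (if i₂ ≤ V then leftBand W i₂
          else if i₂ ≤ L - V then vertBand L W i₂ else rightBand L W i₂) := by
  intro i₁ _ i₂ _ hne
  refine Finset.disjoint_left.mpr fun q hq₁ hq₂ => hne ?_
  have h₁ := index_of_mem_band hq₁
  have h₂ := index_of_mem_band hq₂
  clear hq₁ hq₂
  omega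
end
end

section
/- For any window size W ≥ 0, any index 1 ≤ i ≤ L, and any index j with 1 ≤ j ≤ L and |i−j| ≤ W, the squared distance δ(A_i,B_j) is at least the LB_Keogh term κ_i: if A_i > 𝕌^B_i then δ(A_i,B_j) ≥ δ(A_i,𝕌^B_i); if A_i < 𝕃^B_i then δ(A_i,B_j) ≥ δ(A_i,𝕃^B_i); and in all cases δ(A_i,B_j) ≥ κ_i. -/
noncomputable section

theorem mem_window {L W i j : ℕ} (hj1 : 1 ≤ j) (hjL : j ≤ L)
    (hw : ((i : ℤ) - (j : ℤ)).natAbs ≤ W) :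
    j ∈ Set.Icc (max 1 (i - W)) (min L (i + W)) := by
  simp only [Set.mem_Icc, max_le_iff, le_min_iff]
  omega

theorem le_upperEnv {L W : ℕ} (B : ℕ → ℝ) {i j : ℕ}
    (hj : j ∈ Set.Icc (max 1 (i - W)) (min L (i + W))) : B j ≤ upperEnv L W B i :=
  le_csSup ((Set.finite_Icc _ _).image B).bddAbove (Set.mem_image_of_mem B hj)

theorem lowerEnv_le {L W : ℕ} (B : ℕ → ℝ) {i j : ℕ}
    (hj : j ∈ Set.Icc (max 1 (i - W)) (min L (i + W))) : lowerEnv L W B i ≤ B j :=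
  csInf_le ((Set.finite_Icc _ _).image B).bddBelow (Set.mem_image_of_mem B hj)

/-- For any in-window pair `(i,j)`, the squared distance `δ(A_i,B_j)` is at least the
LB_Keogh term `κ_i`. -/
theorem kappa_le_delta (L W : ℕ) (hL : 1 ≤ L) (A B : ℕ → ℝ) (i j : ℕ)
    (hi1 : 1 ≤ i) (hiL : i ≤ L) (hj1 : 1 ≤ j) (hjL : j ≤ L)
    (hw : ((i : ℤ) - (j : ℤ)).natAbs ≤ W) :
    (upperEnv L W B i < A i → delta (A i) (upperEnv L W B i) ≤ delta (A i) (B j)) ∧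
    (A i < lowerEnv L W B i → delta (A i) (lowerEnv L W B i) ≤ delta (A i) (B j)) ∧
    kappa L W A B i ≤ delta (A i) (B j) := by
  have hj := mem_window hj1 hjL hw
  have hU := le_upperEnv B hj
  have hl := lowerEnv_le B hj
  have above : upperEnv L W B i < A i →
      delta (A i) (upperEnv L W B i) ≤ delta (A i) (B j) := fun h =>
    pow_le_pow_left₀ (sub_nonneg.2 h.le) (sub_le_sub_left hU _) 2
  have below : A i < lowerEnv L W B i →
      delta (A i) (lowerEnv L W B i) ≤ delta (A i) (B j) := fun h =>
    sq_le_sq.2 (abs_le_abs_of_nonpos (by linarith) (by linarith))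
  refine ⟨above, below, ?_⟩
  unfold kappa
  split_ifs with h₁ h₂
  · exact above h₁
  · exact below h₂
  · exact sq_nonneg _
end
end

section
/- For L ≥ 2 and any window size W ≥ 0, LB_Enhanced^1_W(A,B) is uniformly at least as tight as LB_Keogh: LB_Keogh_W(A,B) ≤ LB_Enhanced^1_W(A,B) = δ(A_1,B_1) + Σ_{i=2}^{L−1} κ_i + δ(A_L,B_L). -/
noncomputable section

theorem leftBand_one (W : ℕ) : leftBand W 1 = {(1, 1)} := by
  simp [leftBand]

theorem rightBand_self (L W : ℕ) : rightBand L W L = {(L, L)} := by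
  simp [rightBand]

theorem bandMin_singleton (A B : ℕ → ℝ) (j k : ℕ) : bandMin A B {(j, k)} = delta (A j) (B k) := by
  simp [bandMin]

/-- The LB_Keogh term at `i` is at most the cost of aligning `A i` with any point of `B` in the
window around `i`. -/
theorem kappa_le_delta_s10 {L W i j : ℕ} (A B : ℕ → ℝ)
    (hj : j ∈ Set.Icc (max 1 (i - W)) (min L (i + W))) :
    kappa L W A B i ≤ delta (A i) (B j) := by
  have hfin : (B '' Set.Icc (max 1 (i - W)) (min L (i + W))).Finite :=
    (Set.finite_Icc _ _).image B
  have hU : B j ≤ upperEnv L W B i := le_csSup hfin.bddAbove (Set.mem_image_of_mem B hj)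
  have hL : lowerEnv L W B i ≤ B j := csInf_le hfin.bddBelow (Set.mem_image_of_mem B hj)
  unfold kappa delta
  split_ifs with h₁ h₂
  · nlinarith
  · nlinarith
  · positivity

theorem kappa_le_delta_self {L i : ℕ} (W : ℕ) (A B : ℕ → ℝ) (h₁ : 1 ≤ i) (hL : i ≤ L) :
    kappa L W A B i ≤ delta (A i) (B i) :=
  kappa_le_delta_s10 A B ⟨by omega, by omega⟩

/-- `LB_Enhanced^1_W(A,B) = δ(A_1,B_1) + Σ_{i=2}^{L−1} κ_i + δ(A_L,B_L)` and it is
uniformly at least as tight as `LB_Keogh_W(A,B)`. -/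
theorem lbEnhanced_one_tighter_than_keogh (L W : ℕ) (hL : 2 ≤ L) (A B : ℕ → ℝ) :
    ((∑ i ∈ Finset.Icc 1 1, bandMin A B (leftBand W i)) +
        (∑ i ∈ Finset.Icc (1 + 1) (L - 1), kappa L W A B i) +
        (∑ i ∈ Finset.Icc (L - 1 + 1) L, bandMin A B (rightBand L W i)) =
      delta (A 1) (B 1) + (∑ i ∈ Finset.Icc 2 (L - 1), kappa L W A B i) +
        delta (A L) (B L)) ∧
    (∑ i ∈ Finset.Icc 1 L, kappa L W A B i ≤
      delta (A 1) (B 1) + (∑ i ∈ Finset.Icc 2 (L - 1), kappa L W A B i) +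
        delta (A L) (B L)) := by
  have hlast : L - 1 + 1 = L := by omega
  refine ⟨by simp [hlast, leftBand_one, rightBand_self, bandMin_singleton], ?_⟩
  have hsum : ∑ i ∈ Finset.Icc 1 L, kappa L W A B i =
      kappa L W A B 1 + ∑ i ∈ Finset.Icc 2 (L - 1), kappa L W A B i + kappa L W A B L := by
    obtain ⟨n, rfl⟩ : ∃ n, L = n + 1 := ⟨L - 1, by omega⟩
    rw [Finset.sum_Icc_succ_top (by omega), Nat.add_sub_cancel,
      ← Finset.add_sum_Ioc_eq_sum_Icc (by omega), ← Finset.Icc_add_one_left_eq_Ioc,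
      one_add_one_eq_two]
  rw [hsum]
  gcongr
  · exact kappa_le_delta_self W A B le_rfl (by omega)
  · exact kappa_le_delta_self W A B (by omega) le_rfl
end
end

section
/- LB_Kim is a lower bound: for any window size W ≥ 0, max( δ(A_1,B_1), δ(A_L,B_L), δ(min_i A_i, min_j B_j), δ(max_i A_i, max_j B_j) ) ≤ DTW²_W(A,B). -/
noncomputable section

theorem List.IsChain.exists_mem_eq_of_le_succ {α : Type*} (f : α → ℕ) {l : List α}
    (hl : l.IsChain fun x y => f y ≤ f x + 1) {x y : α} (hx : l.head? = some x)
    (hy : l.getLast? = some y) {i : ℕ} (hxi : f x ≤ i) (hiy : i ≤ f y) : ∃ z ∈ l, f z = i := by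
  induction l generalizing x with
  | nil => simp at hx
  | cons a t ih =>
    obtain rfl : a = x := by simpa using hx
    rcases hxi.eq_or_lt with h | h
    · exact ⟨a, by simp, h⟩
    cases t with
    | nil =>
      obtain rfl : a = y := by simpa using hy
      omega
    | cons b t =>
      rw [List.isChain_cons_cons] at hl
      obtain ⟨z, hz, hzi⟩ := ih hl.2 (x := b) rfl (by simpa using hy) (by omega)
      exact ⟨z, List.mem_cons_of_mem a hz, hzi⟩

theorem sInf_sub_le_sInf {S T : Set ℝ} {d : ℝ} (hS : BddBelow S) (hT : T.Nonempty)
    (h : ∀ t ∈ T, ∃ s ∈ S, |s - t| ≤ d) : sInf S - d ≤ sInf T := by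
  refine le_csInf hT fun t ht => ?_
  obtain ⟨s, hs, hst⟩ := h t ht
  linarith [csInf_le hS hs, (abs_le.1 hst).2]

theorem abs_sInf_sub_sInf_le {S T : Set ℝ} {d : ℝ} (hS : BddBelow S) (hT : BddBelow T)
    (hS' : S.Nonempty) (hT' : T.Nonempty) (hST : ∀ s ∈ S, ∃ t ∈ T, |s - t| ≤ d)
    (hTS : ∀ t ∈ T, ∃ s ∈ S, |s - t| ≤ d) : |sInf S - sInf T| ≤ d := by
  have h₁ := sInf_sub_le_sInf hS hT' hTS
  have h₂ := sInf_sub_le_sInf hT hS' (by simpa only [abs_sub_comm] using hST)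
  rw [abs_le]
  constructor <;> linarith

theorem abs_sSup_sub_sSup_le {S T : Set ℝ} {d : ℝ} (hS : BddAbove S) (hT : BddAbove T)
    (hS' : S.Nonempty) (hT' : T.Nonempty) (hST : ∀ s ∈ S, ∃ t ∈ T, |s - t| ≤ d)
    (hTS : ∀ t ∈ T, ∃ s ∈ S, |s - t| ≤ d) : |sSup S - sSup T| ≤ d := by
  have h := abs_sInf_sub_sInf_le (d := d) hS.neg hT.neg hS'.neg hT'.neg
    (fun s hs => by
      obtain ⟨t, ht, hst⟩ := hST (-s) hs
      exact ⟨-t, by simpa using ht, by rwa [← abs_neg, neg_sub', neg_neg]⟩)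
    (fun t ht => by
      obtain ⟨s, hs, hst⟩ := hTS (-t) ht
      exact ⟨-s, by simpa using hs, by rwa [← abs_neg, neg_sub', neg_neg]⟩)
  rwa [Real.sInf_neg, Real.sInf_neg, ← neg_sub', abs_neg] at h

theorem delta_le_of_abs_sub_le_sqrt {x y c : ℝ} (hc : 0 ≤ c) (h : |x - y| ≤ √c) :
    delta x y ≤ c := by
  rw [delta, ← sq_abs, ← Real.sq_sqrt hc]
  gcongr

theorem delta_le_pathCost (A B : ℕ → ℝ) {p : List (ℕ × ℕ)} {q : ℕ × ℕ} (hq : q ∈ p) :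
    delta (A q.1) (B q.2) ≤ pathCost A B p := by
  refine List.single_le_sum ?_ _ (List.mem_map_of_mem hq)
  intro x hx
  obtain ⟨r, -, rfl⟩ := List.mem_map.1 hx
  exact sq_nonneg _

theorem exists_isWarpingPath {L : ℕ} (hL : 1 ≤ L) (W : ℕ) : ∃ p, IsWarpingPath L W p := by
  refine ⟨(List.range' 1 L).map fun i => (i, i), ?_, ?_, ?_, ?_⟩
  · simp [List.head?_range']; omega
  · simp [List.getLast?_range']; omega
  · refine List.isChain_map_of_isChain (R := fun a b => b = a + 1) _ ?_ ?_
    · rintro a b rfl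
      simp [Step]
    · exact List.isChain_range' 1 L 1
  · simp only [List.mem_map, List.mem_range'_1]
    rintro q ⟨i, hi, rfl⟩
    simp
    omega

namespace IsWarpingPath

variable {L W : ℕ} {p : List (ℕ × ℕ)}

theorem exists_fst_eq (hp : IsWarpingPath L W p) {i : ℕ} (hi : i ∈ Set.Icc 1 L) :
    ∃ q ∈ p, q.1 = i :=
  List.IsChain.exists_mem_eq_of_le_succ Prod.fst
    (hp.2.2.1.imp fun q r h => by rcases h with rfl | rfl | rfl <;> simp) hp.1 hp.2.1 hi.1 hi.2

theorem exists_snd_eq (hp : IsWarpingPath L W p) {j : ℕ} (hj : j ∈ Set.Icc 1 L) :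
    ∃ q ∈ p, q.2 = j :=
  List.IsChain.exists_mem_eq_of_le_succ Prod.snd
    (hp.2.2.1.imp fun q r h => by rcases h with rfl | rfl | rfl <;> simp) hp.1 hp.2.1 hj.1 hj.2

theorem exists_abs_sub_le_of_mem_left (hp : IsWarpingPath L W p) (A B : ℕ → ℝ) :
    ∀ s ∈ A '' Set.Icc 1 L, ∃ t ∈ B '' Set.Icc 1 L, |s - t| ≤ √(pathCost A B p) := by
  rintro _ ⟨i, hi, rfl⟩
  obtain ⟨q, hq, rfl⟩ := hp.exists_fst_eq hi
  have h := hp.2.2.2 q hq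
  exact ⟨_, ⟨q.2, ⟨h.2.2.1, h.2.2.2.1⟩, rfl⟩, Real.abs_le_sqrt (delta_le_pathCost A B hq)⟩

theorem exists_abs_sub_le_of_mem_right (hp : IsWarpingPath L W p) (A B : ℕ → ℝ) :
    ∀ t ∈ B '' Set.Icc 1 L, ∃ s ∈ A '' Set.Icc 1 L, |s - t| ≤ √(pathCost A B p) := by
  rintro _ ⟨j, hj, rfl⟩
  obtain ⟨q, hq, rfl⟩ := hp.exists_snd_eq hj
  have h := hp.2.2.2 q hq
  exact ⟨_, ⟨q.1, ⟨h.1, h.2.1⟩, rfl⟩, Real.abs_le_sqrt (delta_le_pathCost A B hq)⟩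

end IsWarpingPath

/-- LB_Kim is a lower bound on `DTW²_W(A,B)`. -/
theorem lbKim_lower_bound (L W : ℕ) (hL : 1 ≤ L) (A B : ℕ → ℝ) :
    max (max (delta (A 1) (B 1)) (delta (A L) (B L)))
        (max (delta (sInf (A '' Set.Icc 1 L)) (sInf (B '' Set.Icc 1 L)))
             (delta (sSup (A '' Set.Icc 1 L)) (sSup (B '' Set.Icc 1 L)))) ≤
    DTW2 L W A B := by
  refine le_csInf (Set.Nonempty.image _ (exists_isWarpingPath hL W)) ?_
  rintro _ ⟨p, hp : IsWarpingPath L W p, rfl⟩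
  have hfirst := delta_le_pathCost A B (List.mem_of_head? hp.1)
  have hlast := delta_le_pathCost A B (List.mem_of_getLast? hp.2.1)
  have hcost : 0 ≤ pathCost A B p := (sq_nonneg _).trans hfirst
  have hfin (F : ℕ → ℝ) : (F '' Set.Icc 1 L).Finite := (Set.finite_Icc 1 L).image F
  have hne (F : ℕ → ℝ) : (F '' Set.Icc 1 L).Nonempty := (Set.nonempty_Icc.2 hL).image F
  have hleft := hp.exists_abs_sub_le_of_mem_left A B
  have hright := hp.exists_abs_sub_le_of_mem_right A B
  refine max_le (max_le hfirst hlast) (max_le ?_ ?_)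
  · exact delta_le_of_abs_sub_le_sqrt hcost (abs_sInf_sub_sInf_le (hfin A).bddBelow
      (hfin B).bddBelow (hne A) (hne B) hleft hright)
  · exact delta_le_of_abs_sub_le_sqrt hcost (abs_sSup_sub_sSup_le (hfin A).bddAbove
      (hfin B).bddAbove (hne A) (hne B) hleft hright)
end
end
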